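/- Let K ∈ (0,1] and let b be a real number with 0 ≤ b ≤ 1. Then the function H_{K,b} is decreasing on [1/2,1]. -/

import Mathlib

/-- The function `H_{K,b}(x) = (K+2(1−K)(x−1/2))^b / (K+4(1−K)(x−1/2))`. -/
noncomputable def Hfun (K b x : ℝ) : ℝ :=
  (K + 2 * (1 - K) * (x - 1 / 2)) ^ b / (K + 4 * (1 - K) * (x - 1 / 2))

/-- For `b ≤ 1`, the function `u ↦ u ^ b / u` is antitone on the positive reals, stated without
division. -/
theorem Real.rpow_mul_le_rpow_mul_of_le_one {b u v : ℝ} (hb : b ≤ 1) (hu : 0 < u) (huv : u ≤ v) :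
    v ^ b * u ≤ u ^ b * v := by
  have h : (v / u) ^ b ≤ v / u := by
    simpa using Real.rpow_le_rpow_of_exponent_le ((one_le_div hu).2 huv) hb
  rwa [Real.div_rpow (hu.le.trans huv) hu.le, div_le_div_iff₀ (Real.rpow_pos_of_pos hu b) hu,
    mul_comm v] at h

/-- Lemma 3.2(ii): if `K ∈ (0,1]` and `0 ≤ b ≤ 1`, then `H_{K,b}` is decreasing on `[1/2,1]`. -/
theorem Hfun_antitoneOn (K b : ℝ) (hK : K ∈ Set.Ioc (0 : ℝ) 1)
    (hb0 : 0 ≤ b) (hb1 : b ≤ 1) :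
    AntitoneOn (Hfun K b) (Set.Icc (1 / 2 : ℝ) 1) := by
  obtain ⟨hK0, hK1⟩ := hK
  rintro x ⟨hx, -⟩ y - hxy
  have hx0 : 0 ≤ (1 - K) * (x - 1 / 2) := mul_nonneg (by linarith) (by linarith)
  have hmono : (1 - K) * (x - 1 / 2) ≤ (1 - K) * (y - 1 / 2) :=
    mul_le_mul_of_nonneg_left (by linarith) (by linarith)
  simp only [Hfun, mul_assoc]
  generalize (1 - K) * (x - 1 / 2) = s at *
  generalize (1 - K) * (y - 1 / 2) = t at *
  have hu : 0 < K + 2 * s := by linarith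
  rw [div_le_div_iff₀ (by linarith) (by linarith)]
  refine le_of_mul_le_mul_right ?_ hu
  calc (K + 2 * t) ^ b * (K + 4 * s) * (K + 2 * s)
      = (K + 2 * t) ^ b * (K + 2 * s) * (K + 4 * s) := by ring
    _ ≤ (K + 2 * s) ^ b * (K + 2 * t) * (K + 4 * s) :=
        mul_le_mul_of_nonneg_right
          (Real.rpow_mul_le_rpow_mul_of_le_one hb1 hu (by linarith)) (by linarith)
    _ = (K + 2 * s) ^ b * ((K + 2 * t) * (K + 4 * s)) := by ring
    _ ≤ (K + 2 * s) ^ b * ((K + 4 * t) * (K + 2 * s)) :=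
        mul_le_mul_of_nonneg_left (by nlinarith) (Real.rpow_nonneg hu.le b)
    _ = (K + 2 * s) ^ b * (K + 4 * t) * (K + 2 * s) := by ring
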